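/- arXiv:1704.05022 — 2 statements merged into one kernel-verified Lean document; each statement's English description precedes it below -/
import Mathlib

section
/- Theorem 5.3, formula (5.44): in the case of general position, setting I₁^Bgd = J₁/F⁴, I₂^Bgd = J₂/F⁶, I₃^Bgd = −J₃/F⁷ and I₄^Bgd = −J₄/F⁹, the invariant I₇ is expressed through Bagderina's invariants by I₇ = −I₂^Bgd − (1/3)·𝐗(I₄^Bgd) + 𝐗(I₁^Bgd) + 𝐘(I₃^Bgd) + (1/15)·(21·I₁^Bgd − 2·I₄^Bgd)·I₃^Bgd, identically on ℝ². -/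
open Function

noncomputable section

/-- Partial derivative in the first variable. -/
def pdx (f : ℝ → ℝ → ℝ) : ℝ → ℝ → ℝ := fun x y => deriv (fun t => f t y) x

/-- Partial derivative in the second variable. -/
def pdy (f : ℝ → ℝ → ℝ) : ℝ → ℝ → ℝ := fun x y => deriv (fun t => f x t) y

def al0 (P Q R S : ℝ → ℝ → ℝ) : ℝ → ℝ → ℝ := fun x y =>
  pdx Q x y - pdy P x y + 2 * P x y * R x y - 2 * Q x y ^ 2

def al1 (P Q R S : ℝ → ℝ → ℝ) : ℝ → ℝ → ℝ := fun x y =>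
  pdx R x y - pdy Q x y + P x y * S x y - Q x y * R x y

def al2 (P Q R S : ℝ → ℝ → ℝ) : ℝ → ℝ → ℝ := fun x y =>
  pdx S x y - pdy R x y + 2 * Q x y * S x y - 2 * R x y ^ 2

def b1 (P Q R S : ℝ → ℝ → ℝ) : ℝ → ℝ → ℝ := fun x y =>
  pdx (al1 P Q R S) x y - pdy (al0 P Q R S) x y + R x y * al0 P Q R S x y - 2 * Q x y * al1 P Q R S x y + P x y * al2 P Q R S x y

def b2 (P Q R S : ℝ → ℝ → ℝ) : ℝ → ℝ → ℝ := fun x y =>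
  pdx (al2 P Q R S) x y - pdy (al1 P Q R S) x y + S x y * al0 P Q R S x y - 2 * R x y * al1 P Q R S x y + Q x y * al2 P Q R S x y

def g10 (P Q R S : ℝ → ℝ → ℝ) : ℝ → ℝ → ℝ := fun x y =>
  pdx (b1 P Q R S) x y - Q x y * b1 P Q R S x y + P x y * b2 P Q R S x y

def g11 (P Q R S : ℝ → ℝ → ℝ) : ℝ → ℝ → ℝ := fun x y =>
  pdx (b2 P Q R S) x y - R x y * b1 P Q R S x y + Q x y * b2 P Q R S x y

def g20 (P Q R S : ℝ → ℝ → ℝ) : ℝ → ℝ → ℝ := fun x y =>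
  pdy (b1 P Q R S) x y - R x y * b1 P Q R S x y + Q x y * b2 P Q R S x y

def g21 (P Q R S : ℝ → ℝ → ℝ) : ℝ → ℝ → ℝ := fun x y =>
  pdy (b2 P Q R S) x y - S x y * b1 P Q R S x y + R x y * b2 P Q R S x y

def J0 (P Q R S : ℝ → ℝ → ℝ) : ℝ → ℝ → ℝ := fun x y =>
  b2 P Q R S x y ^ 2 * g10 P Q R S x y - b1 P Q R S x y * b2 P Q R S x y * (g20 P Q R S x y + g11 P Q R S x y) + b1 P Q R S x y ^ 2 * g21 P Q R S x y

def Gam0 (P Q R S : ℝ → ℝ → ℝ) : ℝ → ℝ → ℝ := fun x y =>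
  3 * b2 P Q R S x y * g10 P Q R S x y + b1 P Q R S x y * (g20 P Q R S x y - 4 * g11 P Q R S x y)

def Gam1 (P Q R S : ℝ → ℝ → ℝ) : ℝ → ℝ → ℝ := fun x y =>
  b2 P Q R S x y * (4 * g20 P Q R S x y - g11 P Q R S x y) - 3 * b1 P Q R S x y * g21 P Q R S x y

def d10 (P Q R S : ℝ → ℝ → ℝ) : ℝ → ℝ → ℝ := fun x y =>
  pdx (g10 P Q R S) x y - 2 * Q x y * g10 P Q R S x y + P x y * (g20 P Q R S x y + g11 P Q R S x y) - 5 * al0 P Q R S x y * b1 P Q R S x y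

def d20 (P Q R S : ℝ → ℝ → ℝ) : ℝ → ℝ → ℝ := fun x y =>
  pdx (g20 P Q R S) x y - R x y * g10 P Q R S x y + P x y * g21 P Q R S x y - 4 * al1 P Q R S x y * b1 P Q R S x y - al0 P Q R S x y * b2 P Q R S x y

def d30 (P Q R S : ℝ → ℝ → ℝ) : ℝ → ℝ → ℝ := fun x y =>
  pdy (g20 P Q R S) x y - S x y * g10 P Q R S x y + Q x y * g21 P Q R S x y - 4 * al2 P Q R S x y * b1 P Q R S x y - al1 P Q R S x y * b2 P Q R S x y

def d11 (P Q R S : ℝ → ℝ → ℝ) : ℝ → ℝ → ℝ := fun x y =>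
  pdx (g11 P Q R S) x y - R x y * g10 P Q R S x y + P x y * g21 P Q R S x y - al1 P Q R S x y * b1 P Q R S x y - 4 * al0 P Q R S x y * b2 P Q R S x y

def d21 (P Q R S : ℝ → ℝ → ℝ) : ℝ → ℝ → ℝ := fun x y =>
  pdx (g21 P Q R S) x y - R x y * (g20 P Q R S x y + g11 P Q R S x y) + 2 * Q x y * g21 P Q R S x y - 5 * al1 P Q R S x y * b2 P Q R S x y

def d31 (P Q R S : ℝ → ℝ → ℝ) : ℝ → ℝ → ℝ := fun x y =>
  pdy (g21 P Q R S) x y - S x y * (g20 P Q R S x y + g11 P Q R S x y) + 2 * R x y * g21 P Q R S x y - 5 * al2 P Q R S x y * b2 P Q R S x y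

def J1 (P Q R S : ℝ → ℝ → ℝ) : ℝ → ℝ → ℝ := fun x y =>
  b2 P Q R S x y * (d20 P Q R S x y - d11 P Q R S x y) + b1 P Q R S x y * (d21 P Q R S x y - d30 P Q R S x y) + (7 / 5) * (g20 P Q R S x y - g11 P Q R S x y) ^ 2 + (3 / 5) * (g20 P Q R S x y * g11 P Q R S x y - g10 P Q R S x y * g21 P Q R S x y)

def J2 (P Q R S : ℝ → ℝ → ℝ) : ℝ → ℝ → ℝ := fun x y =>
  Gam1 P Q R S x y * (d20 P Q R S x y - d11 P Q R S x y) + Gam0 P Q R S x y * (d21 P Q R S x y - d30 P Q R S x y) + 3 * (g20 P Q R S x y - g11 P Q R S x y) * (g10 P Q R S x y * g21 P Q R S x y - g20 P Q R S x y * g11 P Q R S x y) + (4 / 3) * (g20 P Q R S x y - g11 P Q R S x y) ^ 3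

def J3 (P Q R S : ℝ → ℝ → ℝ) : ℝ → ℝ → ℝ := fun x y =>
  b2 P Q R S x y ^ 3 * d10 P Q R S x y - b1 P Q R S x y * b2 P Q R S x y ^ 2 * (2 * d20 P Q R S x y + d11 P Q R S x y) + b1 P Q R S x y ^ 2 * b2 P Q R S x y * (d30 P Q R S x y + 2 * d21 P Q R S x y) - b1 P Q R S x y ^ 3 * d31 P Q R S x y + 4 * (g20 P Q R S x y - g11 P Q R S x y) * J0 P Q R S x y

def J4 (P Q R S : ℝ → ℝ → ℝ) : ℝ → ℝ → ℝ := fun x y =>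
  -b2 P Q R S x y * (b2 P Q R S x y * Gam0 P Q R S x y + 2 * b1 P Q R S x y * Gam1 P Q R S x y) * (2 * d20 P Q R S x y + d11 P Q R S x y) + b1 P Q R S x y * (2 * b2 P Q R S x y * Gam0 P Q R S x y + b1 P Q R S x y * Gam1 P Q R S x y) * (d30 P Q R S x y + 2 * d21 P Q R S x y) + 3 * b2 P Q R S x y ^ 2 * Gam1 P Q R S x y * d10 P Q R S x y - 3 * b1 P Q R S x y ^ 2 * Gam0 P Q R S x y * d31 P Q R S x y + (66 / 5) * (g20 P Q R S x y - g11 P Q R S x y) ^ 2 * J0 P Q R S x y + (36 / 5) * (g10 P Q R S x y * g21 P Q R S x y - g20 P Q R S x y * g11 P Q R S x y) * J0 P Q R S x y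

def AA (P Q R S : ℝ → ℝ → ℝ) : ℝ → ℝ → ℝ := fun x y =>
  pdy (pdy P) x y - 2 * pdx (pdy Q) x y + pdx (pdx R) x y + 2 * P x y * pdx S x y + S x y * pdx P x y - 3 * P x y * pdy R x y - 3 * R x y * pdy P x y - 3 * Q x y * pdx R x y + 6 * Q x y * pdy Q x y

def BB (P Q R S : ℝ → ℝ → ℝ) : ℝ → ℝ → ℝ := fun x y =>
  pdx (pdx S) x y - 2 * pdx (pdy R) x y + pdy (pdy Q) x y - 2 * S x y * pdy P x y - P x y * pdy S x y + 3 * S x y * pdx Q x y + 3 * Q x y * pdx S x y + 3 * R x y * pdy Q x y - 6 * R x y * pdx R x y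

def GG (P Q R S : ℝ → ℝ → ℝ) : ℝ → ℝ → ℝ := fun x y =>
  -BB P Q R S x y * pdx (BB P Q R S) x y - 3 * AA P Q R S x y * pdy (BB P Q R S) x y + 4 * BB P Q R S x y * pdy (AA P Q R S) x y + 3 * S x y * AA P Q R S x y ^ 2 - 6 * R x y * AA P Q R S x y * BB P Q R S x y + 3 * Q x y * BB P Q R S x y ^ 2

def HH (P Q R S : ℝ → ℝ → ℝ) : ℝ → ℝ → ℝ := fun x y =>
  -AA P Q R S x y * pdy (AA P Q R S) x y - 3 * BB P Q R S x y * pdx (AA P Q R S) x y + 4 * AA P Q R S x y * pdx (BB P Q R S) x y - 3 * P x y * BB P Q R S x y ^ 2 + 6 * Q x y * AA P Q R S x y * BB P Q R S x y - 3 * R x y * AA P Q R S x y ^ 2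

def Phi (P Q R S : ℝ → ℝ → ℝ) : ℝ → ℝ → ℝ := fun x y =>
  AA P Q R S x y * BB P Q R S x y * pdy (AA P Q R S) x y + AA P Q R S x y * BB P Q R S x y * pdx (BB P Q R S) x y - AA P Q R S x y ^ 2 * pdy (BB P Q R S) x y - BB P Q R S x y ^ 2 * pdx (AA P Q R S) x y - P x y * BB P Q R S x y ^ 3 + 3 * Q x y * AA P Q R S x y * BB P Q R S x y ^ 2 - 3 * R x y * AA P Q R S x y ^ 2 * BB P Q R S x y + S x y * AA P Q R S x y ^ 3

def I3v (P Q R S F : ℝ → ℝ → ℝ) : ℝ → ℝ → ℝ := fun x y =>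
  BB P Q R S x y * (HH P Q R S x y * pdx (GG P Q R S) x y - GG P Q R S x y * pdx (HH P Q R S) x y) / (3 * F x y ^ 9) - AA P Q R S x y * (HH P Q R S x y * pdy (GG P Q R S) x y - GG P Q R S x y * pdy (HH P Q R S) x y) / (3 * F x y ^ 9) + (HH P Q R S x y * pdy F x y + GG P Q R S x y * pdx F x y) / (3 * F x y ^ 5) + BB P Q R S x y * GG P Q R S x y ^ 2 * P x y / (3 * F x y ^ 9) - (AA P Q R S x y * GG P Q R S x y ^ 2 - 2 * HH P Q R S x y * BB P Q R S x y * GG P Q R S x y) * Q x y / (3 * F x y ^ 9) + (BB P Q R S x y * HH P Q R S x y ^ 2 - 2 * HH P Q R S x y * AA P Q R S x y * GG P Q R S x y) * R x y / (3 * F x y ^ 9) - AA P Q R S x y * HH P Q R S x y ^ 2 * S x y / (3 * F x y ^ 9)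

def I6v (P Q R S F : ℝ → ℝ → ℝ) : ℝ → ℝ → ℝ := fun x y =>
  (pdy (AA P Q R S) x y - pdx (BB P Q R S) x y) / (3 * F x y ^ 2) - (AA P Q R S x y * pdy F x y - BB P Q R S x y * pdx F x y) / (3 * F x y ^ 3)

def I7v (P Q R S F : ℝ → ℝ → ℝ) : ℝ → ℝ → ℝ := fun x y =>
  (GG P Q R S x y * HH P Q R S x y * pdx (GG P Q R S) x y - GG P Q R S x y ^ 2 * pdx (HH P Q R S) x y + HH P Q R S x y ^ 2 * pdy (GG P Q R S) x y - HH P Q R S x y * GG P Q R S x y * pdy (HH P Q R S) x y) / (3 * F x y ^ 11) + (GG P Q R S x y ^ 3 * P x y + 3 * GG P Q R S x y ^ 2 * HH P Q R S x y * Q x y + 3 * GG P Q R S x y * HH P Q R S x y ^ 2 * R x y + HH P Q R S x y ^ 3 * S x y) / (3 * F x y ^ 11)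

def I8v (P Q R S F : ℝ → ℝ → ℝ) : ℝ → ℝ → ℝ := fun x y =>
  GG P Q R S x y * (AA P Q R S x y * pdx (GG P Q R S) x y + BB P Q R S x y * pdx (HH P Q R S) x y) / (3 * F x y ^ 9) + HH P Q R S x y * (AA P Q R S x y * pdy (GG P Q R S) x y + BB P Q R S x y * pdy (HH P Q R S) x y) / (3 * F x y ^ 9) - 10 * (HH P Q R S x y * pdy F x y + GG P Q R S x y * pdx F x y) / (3 * F x y ^ 5) - BB P Q R S x y * GG P Q R S x y ^ 2 * P x y / (3 * F x y ^ 9) + (AA P Q R S x y * GG P Q R S x y ^ 2 - 2 * HH P Q R S x y * BB P Q R S x y * GG P Q R S x y) * Q x y / (3 * F x y ^ 9) - (BB P Q R S x y * HH P Q R S x y ^ 2 - 2 * HH P Q R S x y * AA P Q R S x y * GG P Q R S x y) * R x y / (3 * F x y ^ 9) + AA P Q R S x y * HH P Q R S x y ^ 2 * S x y / (3 * F x y ^ 9)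

def XX (P Q R S F f : ℝ → ℝ → ℝ) : ℝ → ℝ → ℝ := fun x y =>
  (BB P Q R S x y * pdx f x y - AA P Q R S x y * pdy f x y) / F x y ^ 2

def YY (P Q R S F f : ℝ → ℝ → ℝ) : ℝ → ℝ → ℝ := fun x y =>
  (GG P Q R S x y * pdx f x y + HH P Q R S x y * pdy f x y) / F x y ^ 4

def IBgd1 (P Q R S F : ℝ → ℝ → ℝ) : ℝ → ℝ → ℝ := fun x y =>
  J1 P Q R S x y / F x y ^ 4

def IBgd2 (P Q R S F : ℝ → ℝ → ℝ) : ℝ → ℝ → ℝ := fun x y =>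
  J2 P Q R S x y / F x y ^ 6

def IBgd3 (P Q R S F : ℝ → ℝ → ℝ) : ℝ → ℝ → ℝ := fun x y =>
  -(J3 P Q R S x y / F x y ^ 7)

def IBgd4 (P Q R S F : ℝ → ℝ → ℝ) : ℝ → ℝ → ℝ := fun x y =>
  -(J4 P Q R S x y / F x y ^ 9)


/-- Joint smoothness of a function of two real variables. -/
def Smooth2 (f : ℝ → ℝ → ℝ) : Prop := ContDiff ℝ (⊤ : ℕ∞) (uncurry f)

namespace Smooth2

variable {f g : ℝ → ℝ → ℝ}

theorem const (c : ℝ) : Smooth2 (fun _ _ => c) := contDiff_const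

theorem add (hf : Smooth2 f) (hg : Smooth2 g) : Smooth2 (fun x y => f x y + g x y) :=
  ContDiff.add hf hg

theorem sub (hf : Smooth2 f) (hg : Smooth2 g) : Smooth2 (fun x y => f x y - g x y) :=
  ContDiff.sub hf hg

theorem mul (hf : Smooth2 f) (hg : Smooth2 g) : Smooth2 (fun x y => f x y * g x y) :=
  ContDiff.mul hf hg

theorem pow (hf : Smooth2 f) (n : ℕ) : Smooth2 (fun x y => f x y ^ n) :=
  ContDiff.pow hf n

theorem hasDerivAt_fst (hf : Smooth2 f) (x y : ℝ) :
    HasDerivAt (fun t => f t y) (fderiv ℝ (uncurry f) (x, y) (1, 0)) x := by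
  have h1 : HasFDerivAt (uncurry f) (fderiv ℝ (uncurry f) (x, y)) (x, y) :=
    (ContDiff.differentiable hf (by simp) _).hasFDerivAt
  exact h1.comp_hasDerivAt (f := fun t : ℝ => (t, y)) x
    ((hasDerivAt_id x).prodMk (hasDerivAt_const x y))

theorem hasDerivAt_snd (hf : Smooth2 f) (x y : ℝ) :
    HasDerivAt (fun t => f x t) (fderiv ℝ (uncurry f) (x, y) (0, 1)) y := by
  have h1 : HasFDerivAt (uncurry f) (fderiv ℝ (uncurry f) (x, y)) (x, y) :=
    (ContDiff.differentiable hf (by simp) _).hasFDerivAt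
  exact h1.comp_hasDerivAt (f := fun t : ℝ => (x, t)) y
    ((hasDerivAt_const y x).prodMk (hasDerivAt_id y))

theorem pdx_eq (hf : Smooth2 f) :
    uncurry (pdx f) = fun p => fderiv ℝ (uncurry f) p (1, 0) := by
  funext p
  exact (hf.hasDerivAt_fst p.1 p.2).deriv

theorem pdy_eq (hf : Smooth2 f) :
    uncurry (pdy f) = fun p => fderiv ℝ (uncurry f) p (0, 1) := by
  funext p
  exact (hf.hasDerivAt_snd p.1 p.2).deriv

theorem pdx (hf : Smooth2 f) : Smooth2 (pdx f) := by
  unfold Smooth2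
  rw [hf.pdx_eq]
  exact (ContDiff.fderiv_right (m := (⊤ : ℕ∞)) hf (by simp)).clm_apply contDiff_const

theorem pdy (hf : Smooth2 f) : Smooth2 (pdy f) := by
  unfold Smooth2
  rw [hf.pdy_eq]
  exact (ContDiff.fderiv_right (m := (⊤ : ℕ∞)) hf (by simp)).clm_apply contDiff_const

/-- Mixed second partial derivatives commute. -/
theorem pdy_pdx (hf : Smooth2 f) (x y : ℝ) :
    _root_.pdy (_root_.pdx f) x y = _root_.pdx (_root_.pdy f) x y := by
  have hd : DifferentiableAt ℝ (fderiv ℝ (uncurry f)) (x, y) :=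
    (ContDiff.fderiv_right (m := (⊤ : ℕ∞)) hf (by simp)).differentiable (by simp) _
  have hs : IsSymmSndFDerivAt ℝ (uncurry f) (x, y) :=
    ContDiffAt.isSymmSndFDerivAt (ContDiff.contDiffAt hf)
      (by simp only [minSmoothness_of_isRCLikeNormedField]; exact WithTop.coe_le_coe.2 le_top)
  have e1 : _root_.pdy (_root_.pdx f) x y
      = fderiv ℝ (uncurry (_root_.pdx f)) (x, y) (0, 1) := (hf.pdx.hasDerivAt_snd x y).deriv
  have e2 : _root_.pdx (_root_.pdy f) x y
      = fderiv ℝ (uncurry (_root_.pdy f)) (x, y) (1, 0) := (hf.pdy.hasDerivAt_fst x y).deriv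
  rw [e1, e2, hf.pdx_eq, hf.pdy_eq, fderiv_clm_apply hd (differentiableAt_const _),
    fderiv_clm_apply hd (differentiableAt_const _)]
  simpa using hs.eq (0, 1) (1, 0)

end Smooth2

/-- `f` has partial derivatives `a` and `b` at `(x, y)`. -/
def HasPartials (f : ℝ → ℝ → ℝ) (x y a b : ℝ) : Prop :=
  HasDerivAt (fun t => f t y) a x ∧ HasDerivAt (fun t => f x t) b y

theorem Smooth2.hasPartials {f : ℝ → ℝ → ℝ} (hf : Smooth2 f) (x y : ℝ) :
    HasPartials f x y (_root_.pdx f x y) (_root_.pdy f x y) :=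
  ⟨(hf.hasDerivAt_fst x y).differentiableAt.hasDerivAt,
    (hf.hasDerivAt_snd x y).differentiableAt.hasDerivAt⟩

namespace HasPartials

variable {f g : ℝ → ℝ → ℝ} {x y a b c d : ℝ}

theorem pdx_eq (h : HasPartials f x y a b) : pdx f x y = a := h.1.deriv

theorem pdy_eq (h : HasPartials f x y a b) : pdy f x y = b := h.2.deriv

theorem congr (h : HasPartials f x y a b) (e : ∀ x y, g x y = f x y) : HasPartials g x y a b :=
  funext₂ e ▸ h

theorem const (k : ℝ) : HasPartials (fun _ _ => k) x y 0 0 :=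
  ⟨hasDerivAt_const x k, hasDerivAt_const y k⟩

theorem neg (h : HasPartials f x y a b) : HasPartials (fun x y => -f x y) x y (-a) (-b) :=
  ⟨h.1.fun_neg, h.2.fun_neg⟩

theorem add (h : HasPartials f x y a b) (k : HasPartials g x y c d) :
    HasPartials (fun x y => f x y + g x y) x y (a + c) (b + d) :=
  ⟨h.1.fun_add k.1, h.2.fun_add k.2⟩

theorem sub (h : HasPartials f x y a b) (k : HasPartials g x y c d) :
    HasPartials (fun x y => f x y - g x y) x y (a - c) (b - d) :=
  ⟨h.1.fun_sub k.1, h.2.fun_sub k.2⟩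

theorem mul (h : HasPartials f x y a b) (k : HasPartials g x y c d) :
    HasPartials (fun x y => f x y * g x y) x y (a * g x y + f x y * c) (b * g x y + f x y * d) :=
  ⟨h.1.fun_mul k.1, h.2.fun_mul k.2⟩

theorem sq (h : HasPartials f x y a b) :
    HasPartials (fun x y => f x y ^ 2) x y (2 * f x y * a) (2 * f x y * b) := by
  constructor
  · simpa using h.1.fun_pow 2
  · simpa using h.2.fun_pow 2

theorem div_pow (h : HasPartials f x y a b) (k : HasPartials g x y c d) (hg : g x y ≠ 0) (n : ℕ) :
    HasPartials (fun x y => f x y / g x y ^ (n + 1)) x y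
      (a / g x y ^ (n + 1) - (n + 1) * f x y * c / g x y ^ (n + 2))
      (b / g x y ^ (n + 1) - (n + 1) * f x y * d / g x y ^ (n + 2)) := by
  constructor
  · refine (h.1.fun_div (k.1.fun_pow (n + 1)) (pow_ne_zero _ hg)).congr_deriv ?_
    simp only [Nat.add_sub_cancel]
    push_cast
    field_simp
    ring
  · refine (h.2.fun_div (k.2.fun_pow (n + 1)) (pow_ne_zero _ hg)).congr_deriv ?_
    simp only [Nat.add_sub_cancel]
    push_cast
    field_simp
    ring

end HasPartials

/-- The four coefficients of the equation are smooth. -/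
structure SmoothCoeffs (P Q R S : ℝ → ℝ → ℝ) : Prop where
  P : Smooth2 P
  Q : Smooth2 Q
  R : Smooth2 R
  S : Smooth2 S

/-- The skew part of the covariant derivative of `(b1, b2)`. -/
def skewPart (P Q R S : ℝ → ℝ → ℝ) : ℝ → ℝ → ℝ := fun x y =>
  g20 P Q R S x y - g11 P Q R S x y

/-- The determinant of the covariant derivative of `(b1, b2)`. -/
def covDet (P Q R S : ℝ → ℝ → ℝ) : ℝ → ℝ → ℝ := fun x y =>
  g10 P Q R S x y * g21 P Q R S x y - g20 P Q R S x y * g11 P Q R S x y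

namespace SmoothCoeffs

variable {P Q R S : ℝ → ℝ → ℝ}

theorem smooth2_al0 (h : SmoothCoeffs P Q R S) : Smooth2 (al0 P Q R S) :=
  ((h.Q.pdx.sub h.P.pdy).add (((Smooth2.const 2).mul h.P).mul h.R)).sub
    ((Smooth2.const 2).mul (h.Q.pow 2))

theorem smooth2_al1 (h : SmoothCoeffs P Q R S) : Smooth2 (al1 P Q R S) :=
  ((h.R.pdx.sub h.Q.pdy).add (h.P.mul h.S)).sub (h.Q.mul h.R)

theorem smooth2_al2 (h : SmoothCoeffs P Q R S) : Smooth2 (al2 P Q R S) :=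
  ((h.S.pdx.sub h.R.pdy).add (((Smooth2.const 2).mul h.Q).mul h.S)).sub
    ((Smooth2.const 2).mul (h.R.pow 2))

theorem smooth2_b1 (h : SmoothCoeffs P Q R S) : Smooth2 (b1 P Q R S) := by
  have h0 := h.smooth2_al0
  have h1 := h.smooth2_al1
  have h2 := h.smooth2_al2
  exact (((h1.pdx.sub h0.pdy).add (h.R.mul h0)).sub (((Smooth2.const 2).mul h.Q).mul h1)).add
    (h.P.mul h2)

theorem smooth2_b2 (h : SmoothCoeffs P Q R S) : Smooth2 (b2 P Q R S) := by
  have h0 := h.smooth2_al0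
  have h1 := h.smooth2_al1
  have h2 := h.smooth2_al2
  exact (((h2.pdx.sub h1.pdy).add (h.S.mul h0)).sub (((Smooth2.const 2).mul h.R).mul h1)).add
    (h.Q.mul h2)

theorem smooth2_g10 (h : SmoothCoeffs P Q R S) : Smooth2 (g10 P Q R S) := by
  have k1 := h.smooth2_b1
  have k2 := h.smooth2_b2
  exact (k1.pdx.sub (h.Q.mul k1)).add (h.P.mul k2)

theorem smooth2_g11 (h : SmoothCoeffs P Q R S) : Smooth2 (g11 P Q R S) := by
  have k1 := h.smooth2_b1
  have k2 := h.smooth2_b2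
  exact (k2.pdx.sub (h.R.mul k1)).add (h.Q.mul k2)

theorem smooth2_g20 (h : SmoothCoeffs P Q R S) : Smooth2 (g20 P Q R S) := by
  have k1 := h.smooth2_b1
  have k2 := h.smooth2_b2
  exact (k1.pdy.sub (h.R.mul k1)).add (h.Q.mul k2)

theorem smooth2_g21 (h : SmoothCoeffs P Q R S) : Smooth2 (g21 P Q R S) := by
  have k1 := h.smooth2_b1
  have k2 := h.smooth2_b2
  exact (k2.pdy.sub (h.S.mul k1)).add (h.R.mul k2)

theorem smooth2_skewPart (h : SmoothCoeffs P Q R S) : Smooth2 (skewPart P Q R S) :=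
  h.smooth2_g20.sub h.smooth2_g11

theorem smooth2_covDet (h : SmoothCoeffs P Q R S) : Smooth2 (covDet P Q R S) :=
  (h.smooth2_g10.mul h.smooth2_g21).sub (h.smooth2_g20.mul h.smooth2_g11)

theorem smooth2_J0 (h : SmoothCoeffs P Q R S) : Smooth2 (J0 P Q R S) := by
  have k1 := h.smooth2_b1
  have k2 := h.smooth2_b2
  have h10 := h.smooth2_g10
  have h11 := h.smooth2_g11
  have h20 := h.smooth2_g20
  have h21 := h.smooth2_g21
  exact (((k2.pow 2).mul h10).sub ((k1.mul k2).mul (h20.add h11))).add ((k1.pow 2).mul h21)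

theorem smooth2_Gam0 (h : SmoothCoeffs P Q R S) : Smooth2 (Gam0 P Q R S) := by
  have k1 := h.smooth2_b1
  have k2 := h.smooth2_b2
  have h10 := h.smooth2_g10
  have h11 := h.smooth2_g11
  have h20 := h.smooth2_g20
  have h21 := h.smooth2_g21
  exact (((Smooth2.const 3).mul k2).mul h10).add (k1.mul (h20.sub ((Smooth2.const 4).mul h11)))

theorem smooth2_Gam1 (h : SmoothCoeffs P Q R S) : Smooth2 (Gam1 P Q R S) := by
  have k1 := h.smooth2_b1
  have k2 := h.smooth2_b2
  have h10 := h.smooth2_g10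
  have h11 := h.smooth2_g11
  have h20 := h.smooth2_g20
  have h21 := h.smooth2_g21
  exact (k2.mul (((Smooth2.const 4).mul h20).sub h11)).sub (((Smooth2.const 3).mul k1).mul h21)

/-! ### Relation to the pseudovector fields of the equation -/

theorem AA_eq (h : SmoothCoeffs P Q R S) : AA P Q R S = b1 P Q R S := by
  funext x y
  have hp := h.P.hasPartials x y
  have hq := h.Q.hasPartials x y
  have hr := h.R.hasPartials x y
  have hs := h.S.hasPartials x y
  have e1 : pdx (al1 P Q R S) x y = _ := HasPartials.pdx_eq
    (((h.R.pdx.hasPartials x y).sub (h.Q.pdy.hasPartials x y)).add (hp.mul hs) |>.sub (hq.mul hr))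
  have e0 : pdy (al0 P Q R S) x y = _ := HasPartials.pdy_eq
    (((h.Q.pdx.hasPartials x y).sub (h.P.pdy.hasPartials x y)).add
      (((HasPartials.const 2).mul hp).mul hr) |>.sub ((HasPartials.const 2).mul hq.sq))
  have c := h.Q.pdy_pdx x y
  simp only [AA, b1, e1, e0, c, al0, al1, al2]
  ring

theorem BB_eq (h : SmoothCoeffs P Q R S) : BB P Q R S = b2 P Q R S := by
  funext x y
  have hp := h.P.hasPartials x y
  have hq := h.Q.hasPartials x y
  have hr := h.R.hasPartials x y
  have hs := h.S.hasPartials x y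
  have e1 : pdy (al1 P Q R S) x y = _ := HasPartials.pdy_eq
    (((h.R.pdx.hasPartials x y).sub (h.Q.pdy.hasPartials x y)).add (hp.mul hs) |>.sub (hq.mul hr))
  have e2 : pdx (al2 P Q R S) x y = _ := HasPartials.pdx_eq
    (((h.S.pdx.hasPartials x y).sub (h.R.pdy.hasPartials x y)).add
      (((HasPartials.const 2).mul hq).mul hs) |>.sub ((HasPartials.const 2).mul hr.sq))
  have c := h.R.pdy_pdx x y
  simp only [BB, b2, e1, e2, c, al0, al1, al2]
  ring

theorem GG_eq (h : SmoothCoeffs P Q R S) : GG P Q R S = Gam1 P Q R S := by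
  funext x y
  simp only [GG, h.AA_eq, h.BB_eq, Gam1, g11, g20, g21]
  ring

theorem HH_eq (h : SmoothCoeffs P Q R S) : HH P Q R S = fun x y => -Gam0 P Q R S x y := by
  funext x y
  simp only [HH, h.AA_eq, h.BB_eq, Gam0, g10, g11, g20]
  ring

theorem Phi_eq (h : SmoothCoeffs P Q R S) : Phi P Q R S = fun x y => -J0 P Q R S x y := by
  funext x y
  simp only [Phi, h.AA_eq, h.BB_eq, J0, g10, g11, g20, g21]
  ring

/-! ### Partial derivatives -/

theorem pdx_b1 (x y : ℝ) : pdx (b1 P Q R S) x y = g10 P Q R S x y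
    + Q x y * b1 P Q R S x y - P x y * b2 P Q R S x y := by
  simp only [g10]; ring

theorem pdy_b1 (x y : ℝ) : pdy (b1 P Q R S) x y = g20 P Q R S x y
    + R x y * b1 P Q R S x y - Q x y * b2 P Q R S x y := by
  simp only [g20]; ring

theorem pdx_b2 (x y : ℝ) : pdx (b2 P Q R S) x y = g11 P Q R S x y
    + R x y * b1 P Q R S x y - Q x y * b2 P Q R S x y := by
  simp only [g11]; ring

theorem pdy_b2 (x y : ℝ) : pdy (b2 P Q R S) x y = g21 P Q R S x y
    + S x y * b1 P Q R S x y - R x y * b2 P Q R S x y := by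
  simp only [g21]; ring

theorem pdx_g10 (x y : ℝ) : pdx (g10 P Q R S) x y = d10 P Q R S x y
    + 2 * Q x y * g10 P Q R S x y
    - P x y * (g20 P Q R S x y + g11 P Q R S x y)
    + 5 * al0 P Q R S x y * b1 P Q R S x y := by
  simp only [d10]; ring

theorem pdx_g20 (x y : ℝ) : pdx (g20 P Q R S) x y = d20 P Q R S x y
    + R x y * g10 P Q R S x y - P x y * g21 P Q R S x y
    + 4 * al1 P Q R S x y * b1 P Q R S x y
    + al0 P Q R S x y * b2 P Q R S x y := by
  simp only [d20]; ring

theorem pdy_g20 (x y : ℝ) : pdy (g20 P Q R S) x y = d30 P Q R S x y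
    + S x y * g10 P Q R S x y - Q x y * g21 P Q R S x y
    + 4 * al2 P Q R S x y * b1 P Q R S x y
    + al1 P Q R S x y * b2 P Q R S x y := by
  simp only [d30]; ring

theorem pdx_g11 (x y : ℝ) : pdx (g11 P Q R S) x y = d11 P Q R S x y
    + R x y * g10 P Q R S x y - P x y * g21 P Q R S x y
    + al1 P Q R S x y * b1 P Q R S x y
    + 4 * al0 P Q R S x y * b2 P Q R S x y := by
  simp only [d11]; ring

theorem pdx_g21 (x y : ℝ) : pdx (g21 P Q R S) x y = d21 P Q R S x y
    + R x y * (g20 P Q R S x y + g11 P Q R S x y)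
    - 2 * Q x y * g21 P Q R S x y
    + 5 * al1 P Q R S x y * b2 P Q R S x y := by
  simp only [d21]; ring

theorem pdy_g21 (x y : ℝ) : pdy (g21 P Q R S) x y = d31 P Q R S x y
    + S x y * (g20 P Q R S x y + g11 P Q R S x y)
    - 2 * R x y * g21 P Q R S x y
    + 5 * al2 P Q R S x y * b2 P Q R S x y := by
  simp only [d31]; ring

theorem pdy_g10 (h : SmoothCoeffs P Q R S) (x y : ℝ) : pdy (g10 P Q R S) x y
    = d20 P Q R S x y + 2 * R x y * g10 P Q R S x y
      - Q x y * (g20 P Q R S x y + g11 P Q R S x y)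
      + 5 * al1 P Q R S x y * b1 P Q R S x y := by
  have k1 := h.smooth2_b1.hasPartials x y
  have k2 := h.smooth2_b2.hasPartials x y
  have e1 : pdy (g10 P Q R S) x y = _ := HasPartials.pdy_eq
    (((h.smooth2_b1.pdx.hasPartials x y).sub ((h.Q.hasPartials x y).mul k1)).add
      ((h.P.hasPartials x y).mul k2))
  have e2 : pdx (g20 P Q R S) x y = _ := HasPartials.pdx_eq
    (((h.smooth2_b1.pdy.hasPartials x y).sub ((h.R.hasPartials x y).mul k1)).add
      ((h.Q.hasPartials x y).mul k2))
  rw [e1, h.smooth2_b1.pdy_pdx]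
  simp only [d20, e2, pdx_b1, pdy_b1, pdx_b2, pdy_b2, al0, al1]
  ring

theorem pdy_g11 (h : SmoothCoeffs P Q R S) (x y : ℝ) : pdy (g11 P Q R S) x y
    = d21 P Q R S x y + S x y * g10 P Q R S x y - Q x y * g21 P Q R S x y
      + al2 P Q R S x y * b1 P Q R S x y
      + 4 * al1 P Q R S x y * b2 P Q R S x y := by
  have k1 := h.smooth2_b1.hasPartials x y
  have k2 := h.smooth2_b2.hasPartials x y
  have e1 : pdy (g11 P Q R S) x y = _ := HasPartials.pdy_eq
    (((h.smooth2_b2.pdx.hasPartials x y).sub ((h.R.hasPartials x y).mul k1)).add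
      ((h.Q.hasPartials x y).mul k2))
  have e2 : pdx (g21 P Q R S) x y = _ := HasPartials.pdx_eq
    (((h.smooth2_b2.pdy.hasPartials x y).sub ((h.S.hasPartials x y).mul k1)).add
      ((h.R.hasPartials x y).mul k2))
  rw [e1, h.smooth2_b2.pdy_pdx]
  simp only [d21, e2, pdx_b1, pdy_b1, pdx_b2, pdy_b2, al1, al2]
  ring

/-! ### Directional derivatives -/

/-- Derivative along the vector field `(b2, -b1)`. -/
def derV (P Q R S f : ℝ → ℝ → ℝ) : ℝ → ℝ → ℝ := fun x y =>
  b2 P Q R S x y * pdx f x y - b1 P Q R S x y * pdy f x y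

/-- Derivative along the vector field `(Gam1, -Gam0)`. -/
def derW (P Q R S f : ℝ → ℝ → ℝ) : ℝ → ℝ → ℝ := fun x y =>
  Gam1 P Q R S x y * pdx f x y - Gam0 P Q R S x y * pdy f x y

/-! ### Partial derivatives of the composite quantities -/

theorem pdx_skewPart (h : SmoothCoeffs P Q R S) (x y : ℝ) : pdx (skewPart P Q R S) x y
    = (d20 P Q R S x y + 4 * al1 P Q R S x y * b1 P Q R S x y + al0 P Q R S x y * b2 P Q R S x y)
      - (d11 P Q R S x y + al1 P Q R S x y * b1 P Q R S x y + 4 * al0 P Q R S x y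
        * b2 P Q R S x y) := by
  have kg20 := h.smooth2_g20.hasPartials x y
  have kg11 := h.smooth2_g11.hasPartials x y
  have e : pdx (skewPart P Q R S) x y = _ := HasPartials.pdx_eq
    (kg20.sub kg11)
  rw [e]
  simp only [pdx_g11, pdx_g20]
  ring

theorem pdy_skewPart (h : SmoothCoeffs P Q R S) (x y : ℝ) : pdy (skewPart P Q R S) x y
    = (d30 P Q R S x y + 4 * al2 P Q R S x y * b1 P Q R S x y + al1 P Q R S x y * b2 P Q R S x y)
      - (d21 P Q R S x y + al2 P Q R S x y * b1 P Q R S x y + 4 * al1 P Q R S x y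
        * b2 P Q R S x y) := by
  have kg20 := h.smooth2_g20.hasPartials x y
  have kg11 := h.smooth2_g11.hasPartials x y
  have e : pdy (skewPart P Q R S) x y = _ := HasPartials.pdy_eq
    (kg20.sub kg11)
  rw [e]
  simp only [h.pdy_g11, pdy_g20]
  ring

theorem pdx_covDet (h : SmoothCoeffs P Q R S) (x y : ℝ) : pdx (covDet P Q R S) x y
    = (d10 P Q R S x y + 5 * al0 P Q R S x y * b1 P Q R S x y) * g21 P Q R S x y + g10 P Q R S x y
      * (d21 P Q R S x y + 5 * al1 P Q R S x y * b2 P Q R S x y)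
      - (d20 P Q R S x y + 4 * al1 P Q R S x y * b1 P Q R S x y + al0 P Q R S x y * b2 P Q R S x y)
        * g11 P Q R S x y
      - g20 P Q R S x y * (d11 P Q R S x y + al1 P Q R S x y * b1 P Q R S x y + 4 * al0 P Q R S x y
        * b2 P Q R S x y) := by
  have kg10 := h.smooth2_g10.hasPartials x y
  have kg11 := h.smooth2_g11.hasPartials x y
  have kg20 := h.smooth2_g20.hasPartials x y
  have kg21 := h.smooth2_g21.hasPartials x y
  have e : pdx (covDet P Q R S) x y = _ := HasPartials.pdx_eq
    ((kg10.mul kg21).sub (kg20.mul kg11))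
  rw [e]
  simp only [pdx_g10, pdx_g11, pdx_g20, pdx_g21]
  ring

theorem pdy_covDet (h : SmoothCoeffs P Q R S) (x y : ℝ) : pdy (covDet P Q R S) x y
    = (d20 P Q R S x y + 5 * al1 P Q R S x y * b1 P Q R S x y) * g21 P Q R S x y + g10 P Q R S x y
      * (d31 P Q R S x y + 5 * al2 P Q R S x y * b2 P Q R S x y)
      - (d30 P Q R S x y + 4 * al2 P Q R S x y * b1 P Q R S x y + al1 P Q R S x y * b2 P Q R S x y)
        * g11 P Q R S x y
      - g20 P Q R S x y * (d21 P Q R S x y + al2 P Q R S x y * b1 P Q R S x y + 4 * al1 P Q R S x y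
        * b2 P Q R S x y) := by
  have kg10 := h.smooth2_g10.hasPartials x y
  have kg11 := h.smooth2_g11.hasPartials x y
  have kg20 := h.smooth2_g20.hasPartials x y
  have kg21 := h.smooth2_g21.hasPartials x y
  have e : pdy (covDet P Q R S) x y = _ := HasPartials.pdy_eq
    ((kg10.mul kg21).sub (kg20.mul kg11))
  rw [e]
  simp only [h.pdy_g10, h.pdy_g11, pdy_g20, pdy_g21]
  ring

theorem pdx_J0 (h : SmoothCoeffs P Q R S) (x y : ℝ) : pdx (J0 P Q R S) x y
    = b2 P Q R S x y ^ 2 * d10 P Q R S x y - b1 P Q R S x y * b2 P Q R S x y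
      * (d20 P Q R S x y + d11 P Q R S x y)
      + b1 P Q R S x y ^ 2 * d21 P Q R S x y + 2 * b2 P Q R S x y * g11 P Q R S x y
        * g10 P Q R S x y
      - (g10 P Q R S x y * b2 P Q R S x y + b1 P Q R S x y * g11 P Q R S x y)
        * (g20 P Q R S x y + g11 P Q R S x y)
      + 2 * b1 P Q R S x y * g10 P Q R S x y * g21 P Q R S x y := by
  have kb1 := h.smooth2_b1.hasPartials x y
  have kb2 := h.smooth2_b2.hasPartials x y
  have kg10 := h.smooth2_g10.hasPartials x y
  have kg11 := h.smooth2_g11.hasPartials x y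
  have kg20 := h.smooth2_g20.hasPartials x y
  have kg21 := h.smooth2_g21.hasPartials x y
  have e : pdx (J0 P Q R S) x y = _ := HasPartials.pdx_eq
    (((kb2.sq.mul kg10).sub ((kb1.mul kb2).mul (kg20.add kg11))).add (kb1.sq.mul kg21))
  rw [e]
  simp only [pdx_b1, pdx_b2, pdx_g10, pdx_g11, pdx_g20, pdx_g21]
  ring

theorem pdy_J0 (h : SmoothCoeffs P Q R S) (x y : ℝ) : pdy (J0 P Q R S) x y
    = b2 P Q R S x y ^ 2 * d20 P Q R S x y - b1 P Q R S x y * b2 P Q R S x y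
      * (d30 P Q R S x y + d21 P Q R S x y)
      + b1 P Q R S x y ^ 2 * d31 P Q R S x y + 2 * b2 P Q R S x y * g21 P Q R S x y
        * g10 P Q R S x y
      - (g20 P Q R S x y * b2 P Q R S x y + b1 P Q R S x y * g21 P Q R S x y)
        * (g20 P Q R S x y + g11 P Q R S x y)
      + 2 * b1 P Q R S x y * g20 P Q R S x y * g21 P Q R S x y := by
  have kb1 := h.smooth2_b1.hasPartials x y
  have kb2 := h.smooth2_b2.hasPartials x y
  have kg10 := h.smooth2_g10.hasPartials x y
  have kg11 := h.smooth2_g11.hasPartials x y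
  have kg20 := h.smooth2_g20.hasPartials x y
  have kg21 := h.smooth2_g21.hasPartials x y
  have e : pdy (J0 P Q R S) x y = _ := HasPartials.pdy_eq
    (((kb2.sq.mul kg10).sub ((kb1.mul kb2).mul (kg20.add kg11))).add (kb1.sq.mul kg21))
  rw [e]
  simp only [pdy_b1, pdy_b2, h.pdy_g10, h.pdy_g11, pdy_g20, pdy_g21]
  ring

theorem pdx_Gam0 (h : SmoothCoeffs P Q R S) (x y : ℝ) : pdx (Gam0 P Q R S) x y
    = Q x y * Gam0 P Q R S x y - P x y * Gam1 P Q R S x y + 3 * g11 P Q R S x y * g10 P Q R S x y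
      + 3 * b2 P Q R S x y * (d10 P Q R S x y + 5 * al0 P Q R S x y * b1 P Q R S x y)
        + g10 P Q R S x y * (g20 P Q R S x y - 4 * g11 P Q R S x y)
      + b1 P Q R S x y * ((d20 P Q R S x y + 4 * al1 P Q R S x y * b1 P Q R S x y + al0 P Q R S x y
        * b2 P Q R S x y)
        - 4 * (d11 P Q R S x y + al1 P Q R S x y * b1 P Q R S x y + 4 * al0 P Q R S x y
        * b2 P Q R S x y)) := by
  have kb1 := h.smooth2_b1.hasPartials x y
  have kb2 := h.smooth2_b2.hasPartials x y
  have kg10 := h.smooth2_g10.hasPartials x y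
  have kg11 := h.smooth2_g11.hasPartials x y
  have kg20 := h.smooth2_g20.hasPartials x y
  have e : pdx (Gam0 P Q R S) x y = _ := HasPartials.pdx_eq
    ((((HasPartials.const 3).mul kb2).mul kg10).add
    (kb1.mul (kg20.sub ((HasPartials.const 4).mul kg11))))
  rw [e]
  simp only [pdx_b1, pdx_b2, pdx_g10, pdx_g11, pdx_g20, Gam0, Gam1]
  ring

theorem pdy_Gam0 (h : SmoothCoeffs P Q R S) (x y : ℝ) : pdy (Gam0 P Q R S) x y
    = R x y * Gam0 P Q R S x y - Q x y * Gam1 P Q R S x y + 3 * g21 P Q R S x y * g10 P Q R S x y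
      + 3 * b2 P Q R S x y * (d20 P Q R S x y + 5 * al1 P Q R S x y * b1 P Q R S x y)
        + g20 P Q R S x y * (g20 P Q R S x y - 4 * g11 P Q R S x y)
      + b1 P Q R S x y * ((d30 P Q R S x y + 4 * al2 P Q R S x y * b1 P Q R S x y + al1 P Q R S x y
        * b2 P Q R S x y)
        - 4 * (d21 P Q R S x y + al2 P Q R S x y * b1 P Q R S x y + 4 * al1 P Q R S x y
        * b2 P Q R S x y)) := by
  have kb1 := h.smooth2_b1.hasPartials x y
  have kb2 := h.smooth2_b2.hasPartials x y
  have kg10 := h.smooth2_g10.hasPartials x y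
  have kg11 := h.smooth2_g11.hasPartials x y
  have kg20 := h.smooth2_g20.hasPartials x y
  have e : pdy (Gam0 P Q R S) x y = _ := HasPartials.pdy_eq
    ((((HasPartials.const 3).mul kb2).mul kg10).add
    (kb1.mul (kg20.sub ((HasPartials.const 4).mul kg11))))
  rw [e]
  simp only [pdy_b1, pdy_b2, h.pdy_g10, h.pdy_g11, pdy_g20, Gam0, Gam1]
  ring

theorem pdx_Gam1 (h : SmoothCoeffs P Q R S) (x y : ℝ) : pdx (Gam1 P Q R S) x y
    = R x y * Gam0 P Q R S x y - Q x y * Gam1 P Q R S x y + g11 P Q R S x y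
      * (4 * g20 P Q R S x y - g11 P Q R S x y)
      + b2 P Q R S x y * (4 * (d20 P Q R S x y + 4 * al1 P Q R S x y * b1 P Q R S x y
        + al0 P Q R S x y * b2 P Q R S x y)
        - (d11 P Q R S x y + al1 P Q R S x y * b1 P Q R S x y + 4 * al0 P Q R S x y
        * b2 P Q R S x y))
      - 3 * g10 P Q R S x y * g21 P Q R S x y - 3 * b1 P Q R S x y
        * (d21 P Q R S x y + 5 * al1 P Q R S x y * b2 P Q R S x y) := by
  have kb1 := h.smooth2_b1.hasPartials x y
  have kb2 := h.smooth2_b2.hasPartials x y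
  have kg11 := h.smooth2_g11.hasPartials x y
  have kg20 := h.smooth2_g20.hasPartials x y
  have kg21 := h.smooth2_g21.hasPartials x y
  have e : pdx (Gam1 P Q R S) x y = _ := HasPartials.pdx_eq
    ((kb2.mul (((HasPartials.const 4).mul kg20).sub kg11)).sub
    (((HasPartials.const 3).mul kb1).mul kg21))
  rw [e]
  simp only [pdx_b1, pdx_b2, pdx_g11, pdx_g20, pdx_g21, Gam0, Gam1]
  ring

theorem pdy_Gam1 (h : SmoothCoeffs P Q R S) (x y : ℝ) : pdy (Gam1 P Q R S) x y
    = S x y * Gam0 P Q R S x y - R x y * Gam1 P Q R S x y + g21 P Q R S x y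
      * (4 * g20 P Q R S x y - g11 P Q R S x y)
      + b2 P Q R S x y * (4 * (d30 P Q R S x y + 4 * al2 P Q R S x y * b1 P Q R S x y
        + al1 P Q R S x y * b2 P Q R S x y)
        - (d21 P Q R S x y + al2 P Q R S x y * b1 P Q R S x y + 4 * al1 P Q R S x y
        * b2 P Q R S x y))
      - 3 * g20 P Q R S x y * g21 P Q R S x y - 3 * b1 P Q R S x y
        * (d31 P Q R S x y + 5 * al2 P Q R S x y * b2 P Q R S x y) := by
  have kb1 := h.smooth2_b1.hasPartials x y
  have kb2 := h.smooth2_b2.hasPartials x y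
  have kg11 := h.smooth2_g11.hasPartials x y
  have kg20 := h.smooth2_g20.hasPartials x y
  have kg21 := h.smooth2_g21.hasPartials x y
  have e : pdy (Gam1 P Q R S) x y = _ := HasPartials.pdy_eq
    ((kb2.mul (((HasPartials.const 4).mul kg20).sub kg11)).sub
    (((HasPartials.const 3).mul kb1).mul kg21))
  rw [e]
  simp only [pdy_b1, pdy_b2, h.pdy_g11, pdy_g20, pdy_g21, Gam0, Gam1]
  ring

/-! ### The relative invariants `J3` and `J4` as derivatives of `J0` -/

theorem J3_eq (h : SmoothCoeffs P Q R S) (x y : ℝ) :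
    J3 P Q R S x y = derV P Q R S (J0 P Q R S) x y + 5 * skewPart P Q R S x y * J0 P Q R S x y := by
  rw [derV, h.pdx_J0, h.pdy_J0]
  simp only [J3, J0, skewPart]
  ring

theorem J4_eq (h : SmoothCoeffs P Q R S) (x y : ℝ) :
    J4 P Q R S x y = 3 * derW P Q R S (J0 P Q R S) x y
      + 3 * J0 P Q R S x y * (J1 P Q R S x y + 4 * skewPart P Q R S x y ^ 2 + 9
        * covDet P Q R S x y) := by
  rw [derW, h.pdx_J0, h.pdy_J0]
  simp only [J4, J1, J0, Gam0, Gam1, skewPart, covDet]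
  ring

/-- The second-order identity that remains after eliminating `J3` and `J4`. -/
theorem second_order_identity (h : SmoothCoeffs P Q R S) (x y : ℝ) :
    (GG P Q R S x y * HH P Q R S x y * pdx (GG P Q R S) x y
          - GG P Q R S x y ^ 2 * pdx (HH P Q R S) x y
          + HH P Q R S x y ^ 2 * pdy (GG P Q R S) x y
          - HH P Q R S x y * GG P Q R S x y * pdy (HH P Q R S) x y
        + (GG P Q R S x y ^ 3 * P x y + 3 * GG P Q R S x y ^ 2 * HH P Q R S x y * Q x y
          + 3 * GG P Q R S x y * HH P Q R S x y ^ 2 * R x y + HH P Q R S x y ^ 3 * S x y)) / 3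
    = J2 P Q R S x y * J0 P Q R S x y
      + ((derV P Q R S (Gam1 P Q R S) x y - derW P Q R S (b2 P Q R S) x y) * pdx (J0 P Q R S) x y
        - (derV P Q R S (Gam0 P Q R S) x y - derW P Q R S (b1 P Q R S) x y) * pdy (J0 P Q R S) x y)
      - (J1 P Q R S x y + 8 / 5 * skewPart P Q R S x y ^ 2 + 18 / 5 * covDet P Q R S x y)
        * derV P Q R S (J0 P Q R S) x y
      + J0 P Q R S x y * (8 * skewPart P Q R S x y * derV P Q R S (skewPart P Q R S) x y
        + 9 * derV P Q R S (covDet P Q R S) x y)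
      - 5 * J0 P Q R S x y * derW P Q R S (skewPart P Q R S) x y
      + 4 * skewPart P Q R S x y * derW P Q R S (J0 P Q R S) x y
      - 7 * J1 P Q R S x y * skewPart P Q R S x y * J0 P Q R S x y
      + 2 * skewPart P Q R S x y * J0 P Q R S x y
        * (J1 P Q R S x y + 4 * skewPart P Q R S x y ^ 2 + 9 * covDet P Q R S x y) := by
  have k : HasPartials (HH P Q R S) x y _ _ :=
    (h.smooth2_Gam0.hasPartials x y).neg.congr (congrFun₂ h.HH_eq)
  rw [k.pdx_eq, k.pdy_eq, h.GG_eq, h.HH_eq]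
  simp only [derV, derW]
  rw [h.pdx_J0, h.pdy_J0, h.pdx_Gam0, h.pdy_Gam0, h.pdx_Gam1, h.pdy_Gam1, h.pdx_skewPart,
    h.pdy_skewPart, h.pdx_covDet, h.pdy_covDet, pdx_b1, pdy_b1, pdx_b2, pdy_b2]
  simp only [J1, J2, J0, Gam0, Gam1, skewPart, covDet]
  ring

theorem J1_eq (h : SmoothCoeffs P Q R S) (x y : ℝ) :
    J1 P Q R S x y = derV P Q R S (skewPart P Q R S) x y + 7 / 5 * skewPart P Q R S x y ^ 2
      - 3 / 5 * covDet P Q R S x y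
      + 3 * (al0 P Q R S x y * b2 P Q R S x y ^ 2
        - 2 * (al1 P Q R S x y * (b1 P Q R S x y * b2 P Q R S x y))
        + al2 P Q R S x y * b1 P Q R S x y ^ 2) := by
  rw [derV, h.pdx_skewPart, h.pdy_skewPart]
  simp only [J1, skewPart, covDet]
  ring

theorem smooth2_derV (h : SmoothCoeffs P Q R S) {f : ℝ → ℝ → ℝ} (hf : Smooth2 f) :
    Smooth2 (derV P Q R S f) :=
  (h.smooth2_b2.mul hf.pdx).sub (h.smooth2_b1.mul hf.pdy)

theorem smooth2_derW (h : SmoothCoeffs P Q R S) {f : ℝ → ℝ → ℝ} (hf : Smooth2 f) :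
    Smooth2 (derW P Q R S f) :=
  (h.smooth2_Gam1.mul hf.pdx).sub (h.smooth2_Gam0.mul hf.pdy)

theorem smooth2_J1 (h : SmoothCoeffs P Q R S) : Smooth2 (J1 P Q R S) := by
  have k1 := h.smooth2_b1
  have k2 := h.smooth2_b2
  have kt := h.smooth2_skewPart
  rw [show J1 P Q R S = _ from funext₂ h.J1_eq]
  exact (((h.smooth2_derV kt).add ((Smooth2.const _).mul (kt.pow 2))).sub
    ((Smooth2.const _).mul h.smooth2_covDet)).add ((Smooth2.const 3).mul
      (((h.smooth2_al0.mul (k2.pow 2)).sub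
        ((Smooth2.const 2).mul (h.smooth2_al1.mul (k1.mul k2)))).add
        (h.smooth2_al2.mul (k1.pow 2))))

theorem smooth2_J3 (h : SmoothCoeffs P Q R S) : Smooth2 (J3 P Q R S) := by
  rw [show J3 P Q R S = _ from funext₂ h.J3_eq]
  exact (h.smooth2_derV h.smooth2_J0).add
    (((Smooth2.const 5).mul h.smooth2_skewPart).mul h.smooth2_J0)

theorem smooth2_J4 (h : SmoothCoeffs P Q R S) : Smooth2 (J4 P Q R S) := by
  rw [show J4 P Q R S = _ from funext₂ h.J4_eq]
  exact ((Smooth2.const 3).mul (h.smooth2_derW h.smooth2_J0)).add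
    (((Smooth2.const 3).mul h.smooth2_J0).mul ((h.smooth2_J1.add
      ((Smooth2.const 4).mul (h.smooth2_skewPart.pow 2))).add
      ((Smooth2.const 9).mul h.smooth2_covDet)))

theorem derW_J3 (h : SmoothCoeffs P Q R S) (x y : ℝ) :
    derW P Q R S (J3 P Q R S) x y = derW P Q R S (derV P Q R S (J0 P Q R S)) x y
      + 5 * (derW P Q R S (skewPart P Q R S) x y * J0 P Q R S x y
        + skewPart P Q R S x y * derW P Q R S (J0 P Q R S) x y) := by
  have k : HasPartials (J3 P Q R S) x y _ _ :=
    (((h.smooth2_derV h.smooth2_J0).hasPartials x y).add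
      (((HasPartials.const 5).mul (h.smooth2_skewPart.hasPartials x y)).mul
        (h.smooth2_J0.hasPartials x y))).congr h.J3_eq
  rw [derW, k.pdx_eq, k.pdy_eq]
  simp only [derW]
  ring

theorem derV_J4 (h : SmoothCoeffs P Q R S) (x y : ℝ) :
    derV P Q R S (J4 P Q R S) x y = 3 * derV P Q R S (derW P Q R S (J0 P Q R S)) x y
      + 3 * derV P Q R S (J0 P Q R S) x y
        * (J1 P Q R S x y + 4 * skewPart P Q R S x y ^ 2 + 9 * covDet P Q R S x y)
      + 3 * J0 P Q R S x y * (derV P Q R S (J1 P Q R S) x y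
        + 8 * skewPart P Q R S x y * derV P Q R S (skewPart P Q R S) x y
        + 9 * derV P Q R S (covDet P Q R S) x y) := by
  have k : HasPartials (J4 P Q R S) x y _ _ :=
    (((HasPartials.const 3).mul ((h.smooth2_derW h.smooth2_J0).hasPartials x y)).add
      (((HasPartials.const 3).mul (h.smooth2_J0.hasPartials x y)).mul
        (((h.smooth2_J1.hasPartials x y).add
          ((HasPartials.const 4).mul (h.smooth2_skewPart.hasPartials x y).sq)).add
          ((HasPartials.const 9).mul (h.smooth2_covDet.hasPartials x y))))).congr h.J4_eq
  rw [derV, k.pdx_eq, k.pdy_eq]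
  simp only [derV]
  ring

/-- The commutator of `derV` and `derW`. -/
theorem derV_derW_sub (h : SmoothCoeffs P Q R S) {f : ℝ → ℝ → ℝ} (hf : Smooth2 f) (x y : ℝ) :
    derV P Q R S (derW P Q R S f) x y - derW P Q R S (derV P Q R S f) x y
      = (derV P Q R S (Gam1 P Q R S) x y - derW P Q R S (b2 P Q R S) x y) * pdx f x y
      - (derV P Q R S (Gam0 P Q R S) x y - derW P Q R S (b1 P Q R S) x y) * pdy f x y := by
  have kx := hf.pdx.hasPartials x y
  have ky := hf.pdy.hasPartials x y
  have kV : HasPartials (derV P Q R S f) x y _ _ :=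
    ((h.smooth2_b2.hasPartials x y).mul kx).sub ((h.smooth2_b1.hasPartials x y).mul ky)
  have kW : HasPartials (derW P Q R S f) x y _ _ :=
    ((h.smooth2_Gam1.hasPartials x y).mul kx).sub ((h.smooth2_Gam0.hasPartials x y).mul ky)
  rw [derV, kW.pdx_eq, kW.pdy_eq, derW, kV.pdx_eq, kV.pdy_eq, hf.pdy_pdx]
  simp only [derV, derW]
  ring

/-- Differentiating a quotient by a power of a fifth root of `Phi`. -/
theorem hasPartials_div_pow (h : SmoothCoeffs P Q R S) {F : ℝ → ℝ → ℝ} (hF : Smooth2 F)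
    (hF5 : ∀ x y, F x y ^ 5 = Phi P Q R S x y) {f : ℝ → ℝ → ℝ} {x y a b : ℝ}
    (hf : HasPartials f x y a b) (hne : F x y ≠ 0) (n : ℕ) :
    HasPartials (fun x y => f x y / F x y ^ (n + 1)) x y
      (a / F x y ^ (n + 1) + (n + 1) * f x y * pdx (J0 P Q R S) x y / (5 * F x y ^ (n + 6)))
      (b / F x y ^ (n + 1) + (n + 1) * f x y * pdy (J0 P Q R S) x y / (5 * F x y ^ (n + 6))) := by
  have k := hF.hasPartials x y
  have e (x y : ℝ) : J0 P Q R S x y = -F x y ^ 5 := by rw [hF5, h.Phi_eq, neg_neg]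
  have ke : HasPartials (J0 P Q R S) x y (-(5 * F x y ^ 4 * pdx F x y))
      (-(5 * F x y ^ 4 * pdy F x y)) :=
    HasPartials.congr ⟨(k.1.fun_pow 5).fun_neg, (k.2.fun_pow 5).fun_neg⟩ e
  convert hf.div_pow k hne n using 1
  · rw [ke.pdx_eq]
    field_simp
    ring
  · rw [ke.pdy_eq]
    field_simp
    ring

end SmoothCoeffs


theorem stmt12 (P Q R S : ℝ → ℝ → ℝ)
    (hP : ContDiff ℝ (⊤ : ℕ∞) (uncurry P)) (hQ : ContDiff ℝ (⊤ : ℕ∞) (uncurry Q))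
    (hR : ContDiff ℝ (⊤ : ℕ∞) (uncurry R)) (hS : ContDiff ℝ (⊤ : ℕ∞) (uncurry S)) (F : ℝ → ℝ → ℝ)
    (hF : ContDiff ℝ (⊤ : ℕ∞) (uncurry F)) (hF5 : ∀ x y : ℝ, F x y ^ 5 = Phi P Q R S x y) (hFne : ∀ x y : ℝ, F x y ≠ 0) :
    ∀ x y : ℝ,
      I7v P Q R S F x y =
        - IBgd2 P Q R S F x y - (1 / 3) * XX P Q R S F (IBgd4 P Q R S F) x y
          + XX P Q R S F (IBgd1 P Q R S F) x y + YY P Q R S F (IBgd3 P Q R S F) x y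
          + (1 / 15) * (21 * IBgd1 P Q R S F x y - 2 * IBgd4 P Q R S F x y) * IBgd3 P Q R S F x y := by
  intro x y
  have h : SmoothCoeffs P Q R S := ⟨hP, hQ, hR, hS⟩
  have hne := hFne x y
  have hJ0 : J0 P Q R S x y = -F x y ^ 5 := by rw [hF5, h.Phi_eq, neg_neg]
  have q1 : HasPartials (IBgd1 P Q R S F) x y _ _ :=
    h.hasPartials_div_pow hF hF5 (h.smooth2_J1.hasPartials x y) hne 3
  have q3 : HasPartials (IBgd3 P Q R S F) x y _ _ :=
    (h.hasPartials_div_pow hF hF5 (h.smooth2_J3.hasPartials x y) hne 6).neg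
  have q4 : HasPartials (IBgd4 P Q R S F) x y _ _ :=
    (h.hasPartials_div_pow hF hF5 (h.smooth2_J4.hasPartials x y) hne 8).neg
  have x1 : XX P Q R S F (IBgd1 P Q R S F) x y
      = (SmoothCoeffs.derV P Q R S (J1 P Q R S) x y / F x y ^ 4
        + 4 * J1 P Q R S x y * SmoothCoeffs.derV P Q R S (J0 P Q R S) x y
            / (5 * F x y ^ 9)) / F x y ^ 2 := by
    rw [XX, q1.pdx_eq, q1.pdy_eq, h.AA_eq, h.BB_eq]
    simp only [SmoothCoeffs.derV]
    push_cast
    ring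
  have x4 : XX P Q R S F (IBgd4 P Q R S F) x y
      = -(SmoothCoeffs.derV P Q R S (J4 P Q R S) x y / F x y ^ 9
        + 9 * J4 P Q R S x y * SmoothCoeffs.derV P Q R S (J0 P Q R S) x y
            / (5 * F x y ^ 14)) / F x y ^ 2 := by
    rw [XX, q4.pdx_eq, q4.pdy_eq, h.AA_eq, h.BB_eq]
    simp only [SmoothCoeffs.derV]
    push_cast
    ring
  have y3 : YY P Q R S F (IBgd3 P Q R S F) x y
      = -(SmoothCoeffs.derW P Q R S (J3 P Q R S) x y / F x y ^ 7
        + 7 * J3 P Q R S x y * SmoothCoeffs.derW P Q R S (J0 P Q R S) x y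
            / (5 * F x y ^ 12)) / F x y ^ 4 := by
    rw [YY, q3.pdx_eq, q3.pdy_eq, h.GG_eq, h.HH_eq]
    simp only [SmoothCoeffs.derW]
    push_cast
    ring
  have core := h.second_order_identity x y
  have comm := h.derV_derW_sub h.smooth2_J0 x y
  rw [← comm] at core
  rw [I7v, ← add_div, ← div_div, core, x1, x4, y3, h.derW_J3, h.derV_J4, IBgd1, IBgd2, IBgd3,
    IBgd4, h.J3_eq, h.J4_eq, hJ0]
  field_simp
  ring
end
end

section
/- Values of Bagderina's quantities in special coordinates (formulas (5.30), (5.31), (5.33)): assuming A ≡ 0 and G ≡ 0 identically, B(x,y) ≠ 0 and F(x,y) ≠ 0 for all (x,y), the following identities hold on ℝ²: β₁ = 0, β₂ = B, γ₁₀ = −F⁵/B², γ₂₀ = (1/3)B_x, γ₁₁ = (4/3)B_x, γ₂₁ = B_y + B·R, Γ₀ = −3F⁵/B, and Γ₁ = 0. -/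
open Function

noncomputable section

theorem pdx_eq_fderiv {f : ℝ → ℝ → ℝ} (hf : ContDiff ℝ (⊤ : ℕ∞) (uncurry f)) (x y : ℝ) :
    pdx f x y = fderiv ℝ (uncurry f) (x, y) (1, 0) := by
  have h1 : HasDerivAt (fun t : ℝ => (t, y)) ((1 : ℝ), (0 : ℝ)) x :=
    (hasDerivAt_id x).prodMk (hasDerivAt_const x y)
  exact ((hf.differentiable (by simp) (x, y)).hasFDerivAt.comp_hasDerivAt x h1).deriv

theorem contDiff_pdx {f : ℝ → ℝ → ℝ} (hf : ContDiff ℝ (⊤ : ℕ∞) (uncurry f)) :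
    ContDiff ℝ (⊤ : ℕ∞) (uncurry (pdx f)) := by
  have h : uncurry (pdx f) = fun p : ℝ × ℝ => fderiv ℝ (uncurry f) p (1, 0) :=
    funext fun p => pdx_eq_fderiv hf p.1 p.2
  rw [h]
  exact (hf.fderiv_right (m := (⊤ : ℕ∞)) (by simp)).clm_apply contDiff_const

theorem contDiff_uncurry_flip {f : ℝ → ℝ → ℝ} (hf : ContDiff ℝ (⊤ : ℕ∞) (uncurry f)) :
    ContDiff ℝ (⊤ : ℕ∞) (uncurry (flip f)) :=
  hf.comp (contDiff_snd.prodMk contDiff_fst)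

theorem contDiff_pdy {f : ℝ → ℝ → ℝ} (hf : ContDiff ℝ (⊤ : ℕ∞) (uncurry f)) :
    ContDiff ℝ (⊤ : ℕ∞) (uncurry (pdy f)) :=
  contDiff_uncurry_flip (contDiff_pdx (contDiff_uncurry_flip hf))

theorem pdy_eq_fderiv {f : ℝ → ℝ → ℝ} (hf : ContDiff ℝ (⊤ : ℕ∞) (uncurry f)) (x y : ℝ) :
    pdy f x y = fderiv ℝ (uncurry f) (x, y) (0, 1) := by
  have h1 : HasDerivAt (fun t : ℝ => (x, t)) ((0 : ℝ), (1 : ℝ)) y :=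
    (hasDerivAt_const y x).prodMk (hasDerivAt_id y)
  exact ((hf.differentiable (by simp) (x, y)).hasFDerivAt.comp_hasDerivAt y h1).deriv

theorem hasDerivAt_pdx {f : ℝ → ℝ → ℝ} (hf : ContDiff ℝ (⊤ : ℕ∞) (uncurry f)) (x y : ℝ) :
    HasDerivAt (fun t => f t y) (pdx f x y) x :=
  ((hf.comp (contDiff_id.prodMk contDiff_const) :
    ContDiff ℝ (⊤ : ℕ∞) fun t => f t y).differentiable (by simp) x).hasDerivAt

theorem hasDerivAt_pdy {f : ℝ → ℝ → ℝ} (hf : ContDiff ℝ (⊤ : ℕ∞) (uncurry f)) (x y : ℝ) :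
    HasDerivAt (fun t => f x t) (pdy f x y) y :=
  hasDerivAt_pdx (contDiff_uncurry_flip hf) y x

theorem pdy_pdx_comm {f : ℝ → ℝ → ℝ} (hf : ContDiff ℝ (⊤ : ℕ∞) (uncurry f)) (x y : ℝ) :
    pdy (pdx f) x y = pdx (pdy f) x y := by
  have hd : Differentiable ℝ (fderiv ℝ (uncurry f)) :=
    (hf.fderiv_right (m := (⊤ : ℕ∞)) (by simp)).differentiable (by simp)
  have hx : uncurry (pdx f) = fun p : ℝ × ℝ => fderiv ℝ (uncurry f) p (1, 0) :=
    funext fun p => pdx_eq_fderiv hf p.1 p.2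
  have hy : uncurry (pdy f) = fun p : ℝ × ℝ => fderiv ℝ (uncurry f) p (0, 1) :=
    funext fun p => pdy_eq_fderiv hf p.1 p.2
  rw [pdy_eq_fderiv (contDiff_pdx hf), pdx_eq_fderiv (contDiff_pdy hf), hx, hy,
    fderiv_clm_apply (hd _) (differentiableAt_const _),
    fderiv_clm_apply (hd _) (differentiableAt_const _)]
  simpa using ((contDiff_infty.1 hf 2).contDiffAt (x := (x, y))).isSymmSndFDerivAt (by simp)
    (0, 1) (1, 0)

theorem b1_eq_AA {P Q R S : ℝ → ℝ → ℝ}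
    (hP : ContDiff ℝ (⊤ : ℕ∞) (uncurry P)) (hQ : ContDiff ℝ (⊤ : ℕ∞) (uncurry Q))
    (hR : ContDiff ℝ (⊤ : ℕ∞) (uncurry R)) (hS : ContDiff ℝ (⊤ : ℕ∞) (uncurry S)) :
    b1 P Q R S = AA P Q R S := by
  ext x y
  have h1 : pdx (al1 P Q R S) x y = _ :=
    ((((hasDerivAt_pdx (contDiff_pdx hR) x y).sub (hasDerivAt_pdx (contDiff_pdy hQ) x y)).add
      ((hasDerivAt_pdx hP x y).mul (hasDerivAt_pdx hS x y))).sub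
      ((hasDerivAt_pdx hQ x y).mul (hasDerivAt_pdx hR x y))).deriv
  have h0 : pdy (al0 P Q R S) x y = _ :=
    ((((hasDerivAt_pdy (contDiff_pdx hQ) x y).sub (hasDerivAt_pdy (contDiff_pdy hP) x y)).add
      (((hasDerivAt_pdy hP x y).const_mul 2).mul (hasDerivAt_pdy hR x y))).sub
      (((hasDerivAt_pdy hQ x y).pow 2).const_mul 2)).deriv
  simp only [b1, AA, h1, h0, al0, al1, al2, pdy_pdx_comm hQ]
  push_cast
  ring

theorem b2_eq_BB {P Q R S : ℝ → ℝ → ℝ}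
    (hP : ContDiff ℝ (⊤ : ℕ∞) (uncurry P)) (hQ : ContDiff ℝ (⊤ : ℕ∞) (uncurry Q))
    (hR : ContDiff ℝ (⊤ : ℕ∞) (uncurry R)) (hS : ContDiff ℝ (⊤ : ℕ∞) (uncurry S)) :
    b2 P Q R S = BB P Q R S := by
  ext x y
  have h2 : pdx (al2 P Q R S) x y = _ :=
    ((((hasDerivAt_pdx (contDiff_pdx hS) x y).sub (hasDerivAt_pdx (contDiff_pdy hR) x y)).add
      (((hasDerivAt_pdx hQ x y).const_mul 2).mul (hasDerivAt_pdx hS x y))).sub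
      (((hasDerivAt_pdx hR x y).pow 2).const_mul 2)).deriv
  have h1 : pdy (al1 P Q R S) x y = _ :=
    ((((hasDerivAt_pdy (contDiff_pdx hR) x y).sub (hasDerivAt_pdy (contDiff_pdy hQ) x y)).add
      ((hasDerivAt_pdy hP x y).mul (hasDerivAt_pdy hS x y))).sub
      ((hasDerivAt_pdy hQ x y).mul (hasDerivAt_pdy hR x y))).deriv
  simp only [b2, BB, h2, h1, al0, al1, al2, pdy_pdx_comm hR]
  push_cast
  ring

theorem stmt15 (P Q R S : ℝ → ℝ → ℝ)
    (hP : ContDiff ℝ (⊤ : ℕ∞) (uncurry P)) (hQ : ContDiff ℝ (⊤ : ℕ∞) (uncurry Q))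
    (hR : ContDiff ℝ (⊤ : ℕ∞) (uncurry R)) (hS : ContDiff ℝ (⊤ : ℕ∞) (uncurry S)) (F : ℝ → ℝ → ℝ)
    (hF : ContDiff ℝ (⊤ : ℕ∞) (uncurry F)) (hF5 : ∀ x y : ℝ, F x y ^ 5 = Phi P Q R S x y) (hFne : ∀ x y : ℝ, F x y ≠ 0) (hA : ∀ x y : ℝ, AA P Q R S x y = 0) (hG : ∀ x y : ℝ, GG P Q R S x y = 0)
    (hB : ∀ x y : ℝ, BB P Q R S x y ≠ 0) :
    ∀ x y : ℝ,
      b1 P Q R S x y = 0 ∧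
      b2 P Q R S x y = BB P Q R S x y ∧
      g10 P Q R S x y = -(F x y ^ 5) / BB P Q R S x y ^ 2 ∧
      g20 P Q R S x y = (1 / 3) * pdx (BB P Q R S) x y ∧
      g11 P Q R S x y = (4 / 3) * pdx (BB P Q R S) x y ∧
      g21 P Q R S x y = pdy (BB P Q R S) x y + BB P Q R S x y * R x y ∧
      Gam0 P Q R S x y = -(3 * F x y ^ 5) / BB P Q R S x y ∧
      Gam1 P Q R S x y = 0 := by
  intro x y
  have hA0 : AA P Q R S = fun _ _ => 0 := funext₂ hA
  have hb1 : b1 P Q R S = fun _ _ => 0 := (b1_eq_AA hP hQ hR hS).trans hA0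
  have hb2 : b2 P Q R S = BB P Q R S := b2_eq_BB hP hQ hR hS
  have hB0 := hB x y
  have hBx : pdx (BB P Q R S) x y = 3 * Q x y * BB P Q R S x y := by
    refine mul_left_cancel₀ hB0 ?_
    have h := hG x y
    simp only [GG, hA0, pdy, deriv_const] at h
    linarith
  have hFP : F x y ^ 5 = -P x y * BB P Q R S x y ^ 3 := by
    rw [hF5]
    simp only [Phi, hA0, pdx, pdy, deriv_const]
    ring
  have hg10 : g10 P Q R S x y = P x y * BB P Q R S x y := by
    simp [g10, hb1, hb2, pdx]
  have hg20 : g20 P Q R S x y = Q x y * BB P Q R S x y := by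
    simp [g20, hb1, hb2, pdy]
  have hg11 : g11 P Q R S x y = 4 * Q x y * BB P Q R S x y := by
    simp only [g11, hb1, hb2, hBx]
    ring
  refine ⟨by rw [hb1], by rw [hb2], ?_, ?_, ?_, ?_, ?_, ?_⟩
  · rw [hg10, hFP]
    field_simp
  · rw [hg20, hBx]
    ring
  · rw [hg11, hBx]
    ring
  · simp only [g21, hb1, hb2]
    ring
  · simp only [Gam0, hg10, hb1, hb2, hFP]
    field_simp
    ring
  · simp only [Gam1, hg20, hg11, hb1, hb2]
    ring
end
end
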